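/- Let n be a positive integer, a ∈ (0,2), b > 0 with a + b < n, γ := (n+b−a)/2, α_{a,n} := 2^{a−1} π^{−n/2} Γ((n+a)/2)/|Γ(−a/2)|, and L_{a,b,n} := 2^a Γ((n−b+a)/4) Γ((n+b+a)/4) / (Γ((n+b−a)/4) Γ((n−b−a)/4)). Then for every smooth compactly supported ψ : ℝⁿ → ℂ the ground state representation of the Jordan product holds: α_{a,n} · Re ∫∫ (conj(ψ(x)) − conj(ψ(y)))(|x|^b ψ(x) − |y|^b ψ(y)) / |x−y|^{n+a} dx dy = L_{a,b,n} ∫_{ℝⁿ} |x|^{b−a} |ψ(x)|² dx + α_{a,n} ∫∫ (|x|^b + |y|^b) · |ψ(x)|x|^γ − ψ(y)|y|^γ|² / (2 |x|^γ |x−y|^{n+a} |y|^γ) dx dy. -/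

import Mathlib

open MeasureTheory Real

/-- The constant `α_{a,n} = 2^{a-1} π^{-n/2} Γ((n+a)/2) / |Γ(-a/2)|`. -/
noncomputable def alphaConst (n : ℕ) (a : ℝ) : ℝ :=
  2 ^ (a - 1) * Real.pi ^ (-(n : ℝ) / 2) * Real.Gamma (((n : ℝ) + a) / 2) /
    |Real.Gamma (-a / 2)|

/-- The constant `L_{a,b,n}` in the ground state representation. -/
noncomputable def LConst (n : ℕ) (a b : ℝ) : ℝ :=
  2 ^ a * Real.Gamma (((n : ℝ) - b + a) / 4) * Real.Gamma (((n : ℝ) + b + a) / 4) /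
    (Real.Gamma (((n : ℝ) + b - a) / 4) * Real.Gamma (((n : ℝ) - b - a) / 4))

/-- The function `1 - (1 - v)₊ ^ (β - 1)`. -/
noncomputable def truncDefect (β v : ℝ) : ℝ := 1 - if v < 1 then (1 - v) ^ (β - 1) else 0

lemma measurable_truncDefect (β : ℝ) : Measurable (truncDefect β) := by
  unfold truncDefect
  refine measurable_const.sub (Measurable.ite measurableSet_Iio ?_ measurable_const)
  fun_prop

lemma integrableOn_rpow_mul_one_sub_rpow {x y : ℝ} (hx : 0 < x) (hy : 0 < y) :
    IntegrableOn (fun v : ℝ => v ^ (x - 1) * (1 - v) ^ (y - 1)) (Set.Ioo 0 1) := by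
  have h := Complex.betaIntegral_convergent (u := x) (v := y) (by simpa) (by simpa)
  rw [intervalIntegrable_iff_integrableOn_Ioo_of_le zero_le_one] at h
  refine IntegrableOn.congr_fun (show IntegrableOn _ (Set.Ioo 0 1) volume from h.re) (fun v hv => ?_)
    measurableSet_Ioo
  have h1 : (1 - v : ℝ) ≥ 0 := by linarith [hv.2]
  change RCLike.re ((v : ℂ) ^ ((x : ℂ) - 1) * (1 - (v : ℂ)) ^ ((y : ℂ) - 1)) = _
  rw [← Complex.ofReal_one, ← Complex.ofReal_sub, ← Complex.ofReal_sub, ← Complex.ofReal_sub,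
    ← Complex.ofReal_cpow hv.1.le, ← Complex.ofReal_cpow h1, ← Complex.ofReal_mul]
  simp

lemma integral_rpow_mul_one_sub_rpow {x y : ℝ} (hx : 0 < x) (hy : 0 < y) :
    ∫ v in Set.Ioo (0 : ℝ) 1, v ^ (x - 1) * (1 - v) ^ (y - 1) =
      Gamma x * Gamma y / Gamma (x + y) := by
  have h := ProbabilityTheory.beta_eq_betaIntegralReal x y hx hy
  rw [ProbabilityTheory.beta] at h
  rw [h, Complex.betaIntegral, intervalIntegral.integral_of_le zero_le_one,
    ← integral_Ioc_eq_integral_Ioo]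
  have : ∀ v ∈ Set.Ioc (0 : ℝ) 1, ((v : ℂ) ^ ((x : ℂ) - 1) * (1 - (v : ℂ)) ^ ((y : ℂ) - 1)) =
      ((v ^ (x - 1) * (1 - v) ^ (y - 1) : ℝ) : ℂ) := by
    intro v hv
    have h1 : (1 - v : ℝ) ≥ 0 := by linarith [hv.2]
    rw [← Complex.ofReal_one, ← Complex.ofReal_sub, ← Complex.ofReal_sub, ← Complex.ofReal_sub,
      ← Complex.ofReal_cpow hv.1.le, ← Complex.ofReal_cpow h1, ← Complex.ofReal_mul]
  rw [setIntegral_congr_fun measurableSet_Ioc this, integral_complex_ofReal, Complex.ofReal_re]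

lemma one_sub_one_sub_rpow_le {β v : ℝ} (hβ : 0 < β) (hv0 : 0 ≤ v) (hv1 : v ≤ 1) :
    1 - (1 - v) ^ β ≤ max 1 β * v := by
  rcases le_total β 1 with h | h
  · have h1 : (1 - v) ^ (1 : ℝ) ≤ (1 - v) ^ β :=
      rpow_le_rpow_of_exponent_ge' (by linarith) (by linarith) hβ.le h
    rw [rpow_one] at h1
    rw [max_eq_left h]
    linarith
  · have h1 := one_add_mul_self_le_rpow_one_add (s := -v) (by linarith) h
    rw [max_eq_right h]
    rw [← sub_eq_add_neg] at h1
    linarith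

lemma one_sub_one_sub_rpow_nonneg {β v : ℝ} (hβ : 0 < β) (hv0 : 0 ≤ v) (hv1 : v ≤ 1) :
    0 ≤ 1 - (1 - v) ^ β := by
  linarith [rpow_le_one (x := 1 - v) (z := β) (by linarith) (by linarith) hβ.le]

lemma integrableOn_rpow_mul_one_sub_one_sub_rpow {σ β : ℝ} (hσ1 : σ < 1) (hβ : 0 < β) :
    IntegrableOn (fun v : ℝ => v ^ (-σ - 1) * (1 - (1 - v) ^ β)) (Set.Ioo 0 1) := by
  have hb : IntegrableOn (fun v : ℝ => max 1 β * v ^ (-σ)) (Set.Ioo 0 1) := by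
    have := intervalIntegral.intervalIntegrable_rpow' (a := 0) (b := 1) (r := -σ) (by linarith)
    rw [intervalIntegrable_iff_integrableOn_Ioo_of_le zero_le_one] at this
    exact this.const_mul _
  refine Integrable.mono' hb (by fun_prop) ?_
  refine (ae_restrict_iff' measurableSet_Ioo).2 (.of_forall fun v hv => ?_)
  have h1 := one_sub_one_sub_rpow_le hβ hv.1.le hv.2.le
  have h0 := one_sub_one_sub_rpow_nonneg hβ hv.1.le hv.2.le
  have hp := rpow_pos_of_pos hv.1 (-σ - 1)
  rw [norm_of_nonneg (by positivity)]
  calc _ ≤ v ^ (-σ - 1) * (max 1 β * v) := by gcongr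
    _ = max 1 β * (v ^ (-σ - 1) * v) := by ring
    _ = max 1 β * v ^ (-σ) := by
      rw [← rpow_add_one hv.1.ne']; ring_nf

lemma integral_rpow_mul_one_sub_one_sub_rpow {σ β : ℝ} (hσ1 : σ < 1) (hβ : 0 < β) :
    σ * ∫ v in Set.Ioo (0 : ℝ) 1, v ^ (-σ - 1) * (1 - (1 - v) ^ β) =
      β * (∫ v in Set.Ioo (0 : ℝ) 1, v ^ (-σ) * (1 - v) ^ (β - 1)) - 1 := by
  have hA : IntegrableOn (fun v : ℝ => v ^ (-σ) * (1 - v) ^ (β - 1)) (Set.Ioo 0 1) := by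
    simpa using integrableOn_rpow_mul_one_sub_rpow (x := 1 - σ) (by linarith) hβ
  have hB := integrableOn_rpow_mul_one_sub_one_sub_rpow hσ1 hβ
  have hI : IntegrableOn (fun v : ℝ => β * (v ^ (-σ) * (1 - v) ^ (β - 1)) -
      σ * (v ^ (-σ - 1) * (1 - (1 - v) ^ β))) (Set.Ioo 0 1) :=
    (hA.const_mul β).sub (hB.const_mul σ)
  have key := intervalIntegral.integral_eq_sub_of_hasDerivAt_of_le (a := 0) (b := 1)
    (f := fun v : ℝ => v ^ (-σ) * (1 - (1 - v) ^ β))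
    (f' := fun v : ℝ => β * (v ^ (-σ) * (1 - v) ^ (β - 1)) -
      σ * (v ^ (-σ - 1) * (1 - (1 - v) ^ β))) zero_le_one ?_ ?_ ?_
  · rw [intervalIntegral.integral_of_le zero_le_one, integral_Ioc_eq_integral_Ioo,
      integral_sub (hA.const_mul β) (hB.const_mul σ), integral_const_mul, integral_const_mul] at key
    simp [zero_rpow hβ.ne'] at key
    linarith
  · intro v hv
    rcases hv.1.eq_or_lt with rfl | hv0
    · have hlim : Filter.Tendsto (fun v : ℝ => max 1 β * v ^ (1 - σ))
          (nhdsWithin 0 (Set.Icc 0 1)) (nhds 0) := by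
        have : ContinuousAt (fun v : ℝ => max 1 β * v ^ (1 - σ)) 0 :=
          (continuousAt_rpow_const _ _ (Or.inr (by linarith))).const_mul _
        have h2 := this.tendsto.mono_left (nhdsWithin_le_nhds (s := Set.Icc 0 1))
        simpa [zero_rpow (by linarith : (1 - σ) ≠ 0)] using h2
      unfold ContinuousWithinAt
      simp only [sub_zero, one_rpow, sub_self, mul_zero]
      refine squeeze_zero' ?_ ?_ hlim
      · filter_upwards [self_mem_nhdsWithin] with w hw
        exact mul_nonneg (rpow_nonneg hw.1 _) (one_sub_one_sub_rpow_nonneg hβ hw.1 hw.2)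
      · filter_upwards [self_mem_nhdsWithin] with w hw
        rcases hw.1.eq_or_lt with rfl | hw0
        · simp only [sub_zero, one_rpow, sub_self, mul_zero]
          positivity
        calc w ^ (-σ) * (1 - (1 - w) ^ β) ≤ w ^ (-σ) * (max 1 β * w) := by
              gcongr; exact one_sub_one_sub_rpow_le hβ hw.1 hw.2
          _ = max 1 β * (w ^ (-σ) * w) := by ring
          _ = max 1 β * w ^ (1 - σ) := by rw [← rpow_add_one hw0.ne']; ring_nf
    · refine ContinuousAt.continuousWithinAt ?_
      refine (continuousAt_rpow_const _ _ (Or.inl hv0.ne')).mul (continuousAt_const.sub ?_)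
      exact (continuousAt_const.sub continuousAt_id).rpow_const (Or.inr hβ.le)
  · intro v hv
    have h1 := hasDerivAt_rpow_const (x := v) (p := -σ) (Or.inl hv.1.ne')
    have h2 := ((hasDerivAt_id v).const_sub 1).rpow_const (p := β)
      (Or.inl (by simp only [id]; linarith [hv.2]))
    have h3 := h1.mul (h2.const_sub 1)
    refine h3.congr_deriv ?_
    simp only [id]
    ring
  · rwa [intervalIntegrable_iff_integrableOn_Ioo_of_le zero_le_one]

lemma integrableOn_and_integral_rpow_mul_truncDefect {σ β : ℝ} (hσ0 : 0 < σ) (hσ1 : σ < 1)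
    (hβ : σ < β) :
    IntegrableOn (fun v : ℝ => v ^ (-σ - 1) * truncDefect β v) (Set.Ioi 0) ∧
    ∫ v in Set.Ioi (0 : ℝ), v ^ (-σ - 1) * truncDefect β v =
      |Gamma (-σ)| * Gamma β / Gamma (β - σ) := by
  have hβ0 : 0 < β := hσ0.trans hβ
  have hA : IntegrableOn (fun v : ℝ => v ^ (-σ) * (1 - v) ^ (β - 1)) (Set.Ioo 0 1) := by
    simpa using integrableOn_rpow_mul_one_sub_rpow (x := 1 - σ) (by linarith) hβ0
  have hA' := integral_rpow_mul_one_sub_rpow (x := 1 - σ) (by linarith) hβ0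
  rw [show 1 - σ - 1 = -σ by ring] at hA'
  have hB := integrableOn_rpow_mul_one_sub_one_sub_rpow hσ1 hβ0
  have hAB := integral_rpow_mul_one_sub_one_sub_rpow hσ1 hβ0
  have e1 : Set.EqOn (fun v : ℝ => v ^ (-σ - 1) * (1 - (1 - v) ^ β) -
      v ^ (-σ) * (1 - v) ^ (β - 1)) (fun v => v ^ (-σ - 1) * truncDefect β v) (Set.Ioo 0 1) := by
    intro v hv
    have h1 : 0 < 1 - v := by linarith [hv.2]
    simp only [truncDefect, if_pos hv.2]
    rw [show -σ = -σ - 1 + 1 by ring, rpow_add_one hv.1.ne',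
      show (1 - v) ^ β = (1 - v) ^ (β - 1) * (1 - v) by
        rw [← rpow_add_one h1.ne']; ring_nf]
    ring_nf
  have e2 : Set.EqOn (fun v : ℝ => v ^ (-σ - 1))
      (fun v => v ^ (-σ - 1) * truncDefect β v) (Set.Ici 1) := by
    intro v hv
    simp [truncDefect, not_lt.2 (Set.mem_Ici.1 hv)]
  have i1 : IntegrableOn (fun v => v ^ (-σ - 1) * truncDefect β v) (Set.Ioo 0 1) :=
    (hB.sub hA).congr_fun e1 measurableSet_Ioo
  have i2 : IntegrableOn (fun v => v ^ (-σ - 1) * truncDefect β v) (Set.Ici 1) :=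
    ((integrableOn_Ici_iff_integrableOn_Ioi (by finiteness)).2
      (integrableOn_Ioi_rpow_of_lt (by linarith) one_pos)).congr_fun e2 measurableSet_Ici
  have hun : Set.Ioi (0 : ℝ) = Set.Ioo 0 1 ∪ Set.Ici 1 := by
    rw [Set.Ioo_union_Ici_eq_Ioi one_pos]
  have hdisj : Disjoint (Set.Ioo (0 : ℝ) 1) (Set.Ici 1) :=
    Set.disjoint_left.2 fun v hv hv' => absurd hv.2 (not_lt.2 hv')
  rw [hun]
  refine ⟨i1.union i2, ?_⟩
  rw [setIntegral_union hdisj measurableSet_Ici i1 i2, ← setIntegral_congr_fun measurableSet_Ioo e1,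
    ← setIntegral_congr_fun measurableSet_Ici e2, integral_sub hB hA,
    integral_Ici_eq_integral_Ioi, integral_Ioi_rpow_of_lt (by linarith) one_pos, one_rpow]
  have hB' : ∫ v in Set.Ioo (0 : ℝ) 1, v ^ (-σ - 1) * (1 - (1 - v) ^ β) =
      (β * (Gamma (1 - σ) * Gamma β / Gamma (1 - σ + β)) - 1) / σ := by
    rw [eq_div_iff hσ0.ne', mul_comm, hAB, hA']
  rw [hB', hA']
  have g1 : Gamma (1 - σ) = -σ * Gamma (-σ) := by
    rw [← Gamma_add_one (by linarith)]; ring_nf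
  have g2 : Gamma (1 - σ + β) = (β - σ) * Gamma (β - σ) := by
    rw [← Gamma_add_one (by linarith)]; ring_nf
  have g3 : Gamma (-σ) < 0 := by
    have := Gamma_pos_of_pos (s := 1 - σ) (by linarith)
    rw [g1] at this
    nlinarith
  rw [abs_of_neg g3, g1, g2]
  have g4 := (Gamma_pos_of_pos (s := β - σ) (by linarith)).ne'
  have g5 : β - σ ≠ 0 := by linarith
  have g6 : -σ - 1 + 1 ≠ 0 := by linarith
  have g7 : -σ ≠ 0 := by linarith
  have g8 := hσ0.ne'
  rw [show -σ - 1 + 1 = -σ by ring]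
  field_simp
  ring

lemma integrableOn_and_integral_rpow_mul_comp_div {σ u : ℝ} {φ : ℝ → ℝ}
    (hφ : IntegrableOn (fun v : ℝ => v ^ (-σ - 1) * φ v) (Set.Ioi 0)) (hu : 0 < u) :
    IntegrableOn (fun t : ℝ => t ^ (σ - 1) * φ (u / t)) (Set.Ioi 0) ∧
    ∫ t in Set.Ioi (0 : ℝ), t ^ (σ - 1) * φ (u / t) =
      u ^ σ * ∫ v in Set.Ioi (0 : ℝ), v ^ (-σ - 1) * φ v := by
  have e1 : Set.EqOn
      (fun x : ℝ => (|(-1 : ℝ)| * x ^ ((-1 : ℝ) - 1)) •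
        (fun v : ℝ => v ^ (-σ - 1) * φ v) (x ^ (-1 : ℝ)))
      (fun t : ℝ => t ^ (σ - 1) * φ (1 / t)) (Set.Ioi 0) := by
    intro t ht
    have ht : 0 < t := ht
    simp only [smul_eq_mul, abs_neg, abs_one, one_mul]
    rw [← rpow_mul ht.le, rpow_neg_one, ← mul_assoc, ← rpow_add ht, one_div]
    ring_nf
  have i1 := (integrableOn_Ioi_comp_rpow_iff _ (by norm_num : (-1 : ℝ) ≠ 0)).2 hφ
  have v1 := integral_comp_rpow_Ioi (fun v : ℝ => v ^ (-σ - 1) * φ v)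
    (by norm_num : (-1 : ℝ) ≠ 0)
  rw [setIntegral_congr_fun measurableSet_Ioi e1] at v1
  replace i1 := i1.congr_fun e1 measurableSet_Ioi
  have e2 : Set.EqOn
      (fun x : ℝ => u ^ (σ - 1) *
        (fun t : ℝ => t ^ (σ - 1) * φ (1 / t)) (u⁻¹ * x))
      (fun t : ℝ => t ^ (σ - 1) * φ (u / t)) (Set.Ioi 0) := by
    intro t ht
    have ht : 0 < t := ht
    simp only
    rw [mul_rpow (by positivity) ht.le, inv_rpow hu.le]
    have := rpow_pos_of_pos hu (σ - 1)
    field_simp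
  have i2 := ((integrableOn_Ioi_comp_mul_left_iff
    (fun t : ℝ => t ^ (σ - 1) * φ (1 / t)) 0 (inv_pos.2 hu)).2
      (by simpa using i1)).const_mul (u ^ (σ - 1))
  refine ⟨IntegrableOn.congr_fun i2 e2 measurableSet_Ioi, ?_⟩
  rw [← setIntegral_congr_fun measurableSet_Ioi e2, integral_const_mul,
    integral_comp_mul_left_Ioi (fun t : ℝ => t ^ (σ - 1) * φ (1 / t)) _ (inv_pos.2 hu),
    mul_zero, v1, inv_inv, smul_eq_mul, ← mul_assoc, ← rpow_add_one hu.ne']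
  ring_nf

lemma exp_mul_exp_eq_complete_square {E : Type*} [NormedAddCommGroup E]
    [InnerProductSpace ℝ E] {r t : ℝ} (h : r + t ≠ 0) (x y : E) :
    exp (-(r * ‖y‖ ^ 2)) * exp (-(t * ‖x - y‖ ^ 2)) =
      exp (-(r * t / (r + t) * ‖x‖ ^ 2)) * exp (-((r + t) * ‖(t / (r + t)) • x - y‖ ^ 2)) := by
  rw [← exp_add, ← exp_add, norm_sub_sq_real, norm_sub_sq_real, norm_smul, inner_smul_left]
  simp only [conj_trivial, mul_pow, norm_eq_abs, sq_abs]
  congr 1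
  field_simp
  ring

lemma integral_rpow_mul_exp_neg_mul_norm_sq {E : Type*} [NormedAddCommGroup E]
    {s : ℝ} (hs : 0 < s) {x : E} (hx : x ≠ 0) :
    ∫ u in Set.Ioi (0 : ℝ), u ^ (s / 2 - 1) * exp (-(u * ‖x‖ ^ 2)) =
      Gamma (s / 2) * ‖x‖ ^ (-s) := by
  have hx' : 0 < ‖x‖ := norm_pos_iff.2 hx
  have h := integral_rpow_mul_exp_neg_mul_Ioi (a := s / 2) (r := ‖x‖ ^ 2) (by positivity)
    (by positivity)
  simp_rw [mul_comm _ (‖x‖ ^ 2)]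
  rw [h, mul_comm, one_div, inv_rpow (by positivity), ← rpow_natCast, ← rpow_mul hx'.le,
    rpow_neg hx'.le]
  norm_num
  left
  ring_nf

lemma integrableOn_rpow_mul_exp_neg_mul_norm_sq {E : Type*} [NormedAddCommGroup E]
    {s : ℝ} (hs : 0 < s) {x : E} (hx : x ≠ 0) :
    IntegrableOn (fun u : ℝ => u ^ (s / 2 - 1) * exp (-(u * ‖x‖ ^ 2))) (Set.Ioi 0) := by
  refine Integrable.of_integral_ne_zero ?_
  rw [integral_rpow_mul_exp_neg_mul_norm_sq hs hx]
  have := norm_pos_iff.2 hx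
  have := Gamma_pos_of_pos (half_pos hs)
  positivity

section Gaussian
variable {E : Type*} [NormedAddCommGroup E] [InnerProductSpace ℝ E] [FiniteDimensional ℝ E]
  [MeasurableSpace E] [BorelSpace E]

lemma integrable_exp_neg_mul_norm_sub_sq {t : ℝ} (ht : 0 < t) (x : E) :
    Integrable (fun y : E => exp (-(t * ‖x - y‖ ^ 2))) := by
  have h : Integrable (fun y : E => exp (-t * ‖y‖ ^ 2)) := by
    refine .of_integral_ne_zero ?_
    rw [GaussianFourier.integral_rexp_neg_mul_sq_norm ht]
    positivity
  simpa [norm_sub_rev x] using h.comp_sub_right x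

lemma integral_exp_neg_mul_norm_sub_sq {t : ℝ} (ht : 0 < t) (x : E) :
    ∫ y : E, exp (-(t * ‖x - y‖ ^ 2)) = (π / t) ^ ((Module.finrank ℝ E : ℝ) / 2) := by
  rw [← GaussianFourier.integral_rexp_neg_mul_sq_norm ht (V := E),
    ← integral_sub_right_eq_self (fun y : E => exp (-t * ‖y‖ ^ 2)) x]
  simp [norm_sub_rev x]

lemma integrable_exp_mul_exp {r t : ℝ} (hr : 0 < r) (ht : 0 < t) (x : E) :
    Integrable (fun y : E => exp (-(r * ‖y‖ ^ 2)) * exp (-(t * ‖x - y‖ ^ 2))) := by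
  simp_rw [exp_mul_exp_eq_complete_square (add_pos hr ht).ne']
  exact (integrable_exp_neg_mul_norm_sub_sq (add_pos hr ht) _).const_mul _

lemma integral_exp_mul_exp {r t : ℝ} (hr : 0 < r) (ht : 0 < t) (x : E) :
    ∫ y : E, exp (-(r * ‖y‖ ^ 2)) * exp (-(t * ‖x - y‖ ^ 2)) =
      (π / (r + t)) ^ ((Module.finrank ℝ E : ℝ) / 2) * exp (-(r * t / (r + t) * ‖x‖ ^ 2)) := by
  simp_rw [exp_mul_exp_eq_complete_square (add_pos hr ht).ne']
  rw [integral_const_mul, integral_exp_neg_mul_norm_sub_sq (add_pos hr ht), mul_comm]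

end Gaussian

lemma integrableOn_rpow_mul_one_sub_truncDefect {p β t : ℝ} (hp : 0 < p) (hβ : 0 < β)
    (ht : 0 < t) :
    IntegrableOn (fun u : ℝ => u ^ (p - 1) * (1 - truncDefect β (u / t))) (Set.Ioi 0) := by
  have h1 : IntegrableOn (fun v : ℝ => v ^ (p - 1) * (1 - truncDefect β v)) (Set.Ioi 0) := by
    rw [← Set.Ioo_union_Ici_eq_Ioi one_pos]
    refine ((integrableOn_rpow_mul_one_sub_rpow hp hβ).congr_fun (fun v hv => ?_)
      measurableSet_Ioo).union (integrableOn_zero.congr_fun (fun v hv => ?_) measurableSet_Ici)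
    · simp [truncDefect, if_pos hv.2]
    · simp [truncDefect, not_lt.2 (Set.mem_Ici.1 hv)]
  have h2 := ((integrableOn_Ioi_comp_mul_left_iff
    (fun v : ℝ => v ^ (p - 1) * (1 - truncDefect β v)) 0 (inv_pos.2 ht)).2
      (by simpa using h1)).const_mul (t ^ (p - 1))
  refine IntegrableOn.congr_fun h2 (fun u hu => ?_) measurableSet_Ioi
  have hu : 0 < u := hu
  rw [mul_rpow (by positivity) hu.le, inv_rpow ht.le]
  have := rpow_pos_of_pos ht (p - 1)
  field_simp

lemma one_sub_truncDefect_nonneg (β v : ℝ) : 0 ≤ 1 - truncDefect β v := by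
  unfold truncDefect
  split_ifs with h
  · have : 0 ≤ (1 - v) ^ (β - 1) := rpow_nonneg (by linarith) _
    linarith
  · simp

lemma integrableOn_rpow_mul_exp_mul_one_sub_truncDefect {p β t c : ℝ} (hp : 0 < p) (hβ : 0 < β)
    (ht : 0 < t) (hc : 0 ≤ c) :
    IntegrableOn (fun u : ℝ => u ^ (p - 1) * exp (-(u * c)) * (1 - truncDefect β (u / t)))
      (Set.Ioi 0) := by
  have hm := measurable_truncDefect β
  refine Integrable.mono' (integrableOn_rpow_mul_one_sub_truncDefect hp hβ ht)
    (by fun_prop) ((ae_restrict_iff' measurableSet_Ioi).2 (.of_forall fun u hu => ?_))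
  have hu : 0 < u := hu
  have h1 := one_sub_truncDefect_nonneg β (u / t)
  have h2 : exp (-(u * c)) ≤ 1 := exp_le_one_iff.2 (by nlinarith)
  rw [norm_of_nonneg (by positivity)]
  gcongr
  exact mul_le_of_le_one_right (by positivity) h2

/-- Change of variables `r = u / (1 - u / t)`, in other words `1 / u = 1 / r + 1 / t`. -/
lemma integrableOn_and_integral_rpow_mul_gaussian {s d t c : ℝ} (hs : 0 < s) (hsd : s < d)
    (ht : 0 < t) (hc : 0 ≤ c) :
    IntegrableOn (fun r : ℝ => r ^ (s / 2 - 1) *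
      ((π / (r + t)) ^ (d / 2) * exp (-(r * t / (r + t) * c)))) (Set.Ioi 0) ∧
    ∫ r in Set.Ioi (0 : ℝ), r ^ (s / 2 - 1) *
        ((π / (r + t)) ^ (d / 2) * exp (-(r * t / (r + t) * c))) =
      (π / t) ^ (d / 2) * ∫ u in Set.Ioi (0 : ℝ), u ^ (s / 2 - 1) * exp (-(u * c)) *
        (1 - truncDefect ((d - s) / 2) (u / t)) := by
  set f : ℝ → ℝ := fun u => u / (1 - u / t) with hf
  set f' : ℝ → ℝ := fun u => 1 / (1 - u / t) ^ 2 with hf'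
  have hw : ∀ u ∈ Set.Ioo 0 t, 0 < 1 - u / t := fun u hu => by
    have := (div_lt_one ht).2 hu.2
    linarith
  have hder : ∀ u ∈ Set.Ioo 0 t, HasDerivWithinAt f (f' u) (Set.Ioo 0 t) u := by
    intro u hu
    have h := (hasDerivAt_id u).div (((hasDerivAt_id u).div_const t).const_sub 1) (hw u hu).ne'
    refine (h.congr_deriv ?_).hasDerivWithinAt
    simp only [id, hf']
    have := (hw u hu).ne'
    congr 1
    field_simp
    ring
  have hinj : Set.InjOn f (Set.Ioo 0 t) := by
    intro u hu v hv huv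
    simp only [hf] at huv
    rw [div_eq_div_iff (hw u hu).ne' (hw v hv).ne'] at huv
    field_simp at huv
    nlinarith
  have himg : f '' Set.Ioo 0 t = Set.Ioi 0 := by
    ext r
    constructor
    · rintro ⟨u, hu, rfl⟩
      exact div_pos hu.1 (hw u hu)
    · intro hr
      have hr : 0 < r := hr
      refine ⟨r * t / (r + t), ⟨by positivity, ?_⟩, ?_⟩
      · rw [div_lt_iff₀ (by positivity)]
        nlinarith
      · simp only [hf]
        have : 1 - r * t / (r + t) / t = t / (r + t) := by field_simp; ring
        rw [this]
        field_simp
  have hpt : ∀ u ∈ Set.Ioo 0 t, |f' u| • ((f u) ^ (s / 2 - 1) *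
      ((π / (f u + t)) ^ (d / 2) * exp (-(f u * t / (f u + t) * c)))) =
      (π / t) ^ (d / 2) * (u ^ (s / 2 - 1) * exp (-(u * c)) *
        (1 - truncDefect ((d - s) / 2) (u / t))) := by
    intro u hu
    have hw' := hw u hu
    have hlt : u / t < 1 := by linarith
    simp only [truncDefect, if_pos hlt, sub_sub_cancel, smul_eq_mul]
    set w := 1 - u / t with hwdef
    have hu' : u = t * (1 - w) := by rw [hwdef]; field_simp; ring
    have e1 : f u = u / w := rfl
    have e2 : f u + t = t / w := by rw [e1, hu']; field_simp; ring
    have e3 : f u * t / (f u + t) = u := by rw [e2, e1]; field_simp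
    have e4 : |f' u| = w ^ (-2 : ℝ) := by
      simp only [hf', ← hwdef]
      rw [abs_of_pos (by positivity), rpow_neg hw'.le, one_div]
      norm_num
    have e5 : π / (f u + t) = π / t * w := by rw [e2]; field_simp
    rw [e3, e4, e5, e1, mul_rpow (by positivity) hw'.le, div_rpow hu.1.le hw'.le]
    have e6 : w ^ ((d - s) / 2 - 1) = w ^ (-2 : ℝ) / w ^ (s / 2 - 1) * w ^ (d / 2) := by
      rw [← rpow_sub hw', ← rpow_add hw']; ring_nf
    rw [e6]
    ring
  have hG := (integrableOn_rpow_mul_exp_mul_one_sub_truncDefect (p := s / 2)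
    (β := (d - s) / 2) (t := t) (by linarith) (by linarith) ht hc)
  have hzero : ∀ u ∈ Set.Ioi (0 : ℝ) \ Set.Ioo 0 t, u ^ (s / 2 - 1) * exp (-(u * c)) *
      (1 - truncDefect ((d - s) / 2) (u / t)) = 0 := by
    intro u hu
    have h1 : ¬ u / t < 1 := fun h => hu.2 ⟨hu.1, (div_lt_one ht).1 h⟩
    simp [truncDefect, if_neg h1]
  constructor
  · rw [← himg, integrableOn_image_iff_integrableOn_abs_deriv_smul measurableSet_Ioo hder hinj]
    refine IntegrableOn.congr_fun ?_ (fun u hu => (hpt u hu).symm) measurableSet_Ioo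
    exact (hG.mono_set (Set.Ioo_subset_Ioi_self)).const_mul _
  · rw [← himg, integral_image_eq_integral_abs_deriv_smul measurableSet_Ioo hder hinj,
      setIntegral_congr_fun measurableSet_Ioo hpt, integral_const_mul, himg,
      setIntegral_eq_of_subset_of_forall_sdiff_eq_zero measurableSet_Ioi
        Set.Ioo_subset_Ioi_self hzero]

section Riesz
variable {E : Type*} [NormedAddCommGroup E] [InnerProductSpace ℝ E] [FiniteDimensional ℝ E]
  [MeasurableSpace E] [BorelSpace E] [Nontrivial E]

lemma integrable_and_integral_rpow_norm_mul_gaussian {s t : ℝ} (hs : 0 < s)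
    (hsd : s < Module.finrank ℝ E) (ht : 0 < t) (x : E) :
    Integrable (fun y : E => ‖y‖ ^ (-s) * exp (-(t * ‖x - y‖ ^ 2))) ∧
    ∫ y : E, ‖y‖ ^ (-s) * exp (-(t * ‖x - y‖ ^ 2)) =
      (π / t) ^ ((Module.finrank ℝ E : ℝ) / 2) / Gamma (s / 2) *
        ∫ u in Set.Ioi (0 : ℝ), u ^ (s / 2 - 1) * exp (-(u * ‖x‖ ^ 2)) *
          (1 - truncDefect ((Module.finrank ℝ E - s) / 2) (u / t)) := by
  have hΓ := Gamma_pos_of_pos (half_pos hs)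
  obtain ⟨hi, hv⟩ := integrableOn_and_integral_rpow_mul_gaussian hs hsd ht (sq_nonneg ‖x‖)
  set F : E × ℝ → ℝ := fun z => z.2 ^ (s / 2 - 1) *
    (exp (-(z.2 * ‖z.1‖ ^ 2)) * exp (-(t * ‖x - z.1‖ ^ 2))) with hF
  have hFm : AEStronglyMeasurable F (volume.prod (volume.restrict (Set.Ioi 0))) := by
    refine Measurable.aestronglyMeasurable ?_
    fun_prop
  have hFr : ∀ r ∈ Set.Ioi (0 : ℝ), ∫ y : E, F (y, r) = r ^ (s / 2 - 1) *
      ((π / (r + t)) ^ ((Module.finrank ℝ E : ℝ) / 2) * exp (-(r * t / (r + t) * ‖x‖ ^ 2))) := by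
    intro r hr
    simp only [hF]
    rw [integral_const_mul, integral_exp_mul_exp hr ht]
  have hFn : ∀ r ∈ Set.Ioi (0 : ℝ), ∀ y : E, ‖F (y, r)‖ = F (y, r) := by
    intro r hr y
    have hr : 0 < r := hr
    exact norm_of_nonneg (by simp only [hF]; positivity)
  have hFi : Integrable F (volume.prod (volume.restrict (Set.Ioi 0))) := by
    refine (integrable_prod_iff' hFm).2 ⟨?_, ?_⟩
    · refine (ae_restrict_iff' measurableSet_Ioi).2 (.of_forall fun r hr => ?_)
      exact (integrable_exp_mul_exp hr ht x).const_mul (r ^ (s / 2 - 1))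
    · refine IntegrableOn.congr_fun hi (fun r hr => ?_) measurableSet_Ioi
      simp only [hFn r hr]
      exact (hFr r hr).symm
  have hFy : ∀ᵐ y : E, ∫ r in Set.Ioi (0 : ℝ), F (y, r) =
      Gamma (s / 2) * (‖y‖ ^ (-s) * exp (-(t * ‖x - y‖ ^ 2))) := by
    filter_upwards [compl_mem_ae_iff.2 (measure_singleton (0 : E))] with y hy
    simp only [hF, ← mul_assoc]
    rw [integral_mul_const, integral_rpow_mul_exp_neg_mul_norm_sq hs hy]
  have h1 := (hFi.integral_prod_left.congr hFy).const_mul (Gamma (s / 2))⁻¹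
  simp only [inv_mul_cancel_left₀ hΓ.ne'] at h1
  refine ⟨h1, ?_⟩
  have h2 := integral_integral_swap (f := fun y r => F (y, r)) hFi
  rw [integral_congr_ae hFy, integral_const_mul, setIntegral_congr_fun measurableSet_Ioi hFr,
    hv] at h2
  rw [div_mul_eq_mul_div, eq_div_iff hΓ.ne', ← h2, mul_comm]

/-- The mean of `‖x‖ ^ (-s) - ‖y‖ ^ (-s)` in `y` against a Gaussian centred at `x`. -/
lemma integrable_and_integral_rpow_norm_sub_mul_gaussian {s t : ℝ} (hs : 0 < s)
    (hsd : s < Module.finrank ℝ E) (ht : 0 < t) {x : E} (hx : x ≠ 0) :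
    Integrable (fun y : E => (‖x‖ ^ (-s) - ‖y‖ ^ (-s)) * exp (-(t * ‖x - y‖ ^ 2))) ∧
    ∫ y : E, (‖x‖ ^ (-s) - ‖y‖ ^ (-s)) * exp (-(t * ‖x - y‖ ^ 2)) =
      (π / t) ^ ((Module.finrank ℝ E : ℝ) / 2) / Gamma (s / 2) *
        ∫ u in Set.Ioi (0 : ℝ), u ^ (s / 2 - 1) * exp (-(u * ‖x‖ ^ 2)) *
          truncDefect ((Module.finrank ℝ E - s) / 2) (u / t) := by
  have hΓ := Gamma_pos_of_pos (half_pos hs)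
  obtain ⟨hi, hv⟩ := integrable_and_integral_rpow_norm_mul_gaussian hs hsd ht x
  have hg := integrable_exp_neg_mul_norm_sub_sq ht x
  simp only [sub_mul]
  refine ⟨(hg.const_mul _).sub hi, ?_⟩
  rw [integral_sub (hg.const_mul _) hi, integral_const_mul, hv,
    integral_exp_neg_mul_norm_sub_sq ht x]
  have h1 := integrableOn_rpow_mul_exp_neg_mul_norm_sq hs hx
  have h2 := integrableOn_rpow_mul_exp_mul_one_sub_truncDefect (p := s / 2)
    (β := (Module.finrank ℝ E - s) / 2) (t := t) (by linarith) (by linarith) ht (sq_nonneg ‖x‖)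
  have h3 : ∫ u in Set.Ioi (0 : ℝ), u ^ (s / 2 - 1) * exp (-(u * ‖x‖ ^ 2)) *
      truncDefect ((Module.finrank ℝ E - s) / 2) (u / t) = Gamma (s / 2) * ‖x‖ ^ (-s) -
      ∫ u in Set.Ioi (0 : ℝ), u ^ (s / 2 - 1) * exp (-(u * ‖x‖ ^ 2)) *
          (1 - truncDefect ((Module.finrank ℝ E - s) / 2) (u / t)) := by
    rw [← integral_rpow_mul_exp_neg_mul_norm_sq hs hx, ← integral_sub h1 h2]
    congr 1
    ext u
    ring
  rw [h3]
  generalize ∫ u in Set.Ioi (0 : ℝ), u ^ (s / 2 - 1) * exp (-(u * ‖x‖ ^ 2)) *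
    (1 - truncDefect ((Module.finrank ℝ E - s) / 2) (u / t)) = I
  field_simp

end Riesz

section RieszSubordination
variable {E : Type*} [NormedAddCommGroup E] [InnerProductSpace ℝ E] [FiniteDimensional ℝ E]
  [MeasurableSpace E] [BorelSpace E] [Nontrivial E]

/-- The constant in `(-Δ) ^ (a / 2) ‖x‖ ^ (-s) = κ ‖x‖ ^ (-s - a)` on a `d`-dimensional space, up
to the factor `2 ^ a π ^ (-d / 2) / |Γ(-a / 2)|`. -/
noncomputable def rieszFactor (d a s : ℝ) : ℝ :=
  π ^ (d / 2) / Gamma (s / 2) * (Gamma ((s + a) / 2) *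
    (|Gamma (-(a / 2))| * Gamma ((d - s) / 2) / Gamma ((d - s) / 2 - a / 2)))

lemma exists_integral_norm_gaussian_mean_le {a s : ℝ} (ha0 : 0 < a) (ha2 : a < 2) (hs : 0 < s)
    (hsd : s + a < Module.finrank ℝ E) :
    ∃ C : ℝ, ∀ x : E, x ≠ 0 →
      let m : ℝ → ℝ := fun t => t ^ ((Module.finrank ℝ E + a) / 2 - 1) *
        ∫ y : E, (‖x‖ ^ (-s) - ‖y‖ ^ (-s)) * exp (-(t * ‖x - y‖ ^ 2))
      IntegrableOn m (Set.Ioi 0) ∧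
      ∫ t in Set.Ioi (0 : ℝ), m t = rieszFactor (Module.finrank ℝ E) a s * ‖x‖ ^ (-(s + a)) ∧
      ∫ t in Set.Ioi (0 : ℝ), ‖m t‖ ≤ C * ‖x‖ ^ (-(s + a)) := by
  set d : ℝ := ((Module.finrank ℝ E : ℕ) : ℝ) with hd
  set β : ℝ := (d - s) / 2 with hβ
  have hΓ := Gamma_pos_of_pos (half_pos hs)
  obtain ⟨hi, hv⟩ := integrableOn_and_integral_rpow_mul_truncDefect (σ := a / 2) (β := β)
    (by linarith) (by linarith) (by rw [hβ]; linarith)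
  have hi' : IntegrableOn (fun v : ℝ => v ^ (-(a / 2) - 1) * |truncDefect β v|) (Set.Ioi 0) := by
    refine IntegrableOn.congr_fun hi.norm (fun v hv => ?_) measurableSet_Ioi
    have hv : 0 < v := hv
    rw [norm_mul, norm_eq_abs, norm_eq_abs, abs_of_pos (rpow_pos_of_pos hv _)]
  set K : ℝ := ∫ v in Set.Ioi (0 : ℝ), v ^ (-(a / 2) - 1) * |truncDefect β v| with hK
  have hm := measurable_truncDefect β
  refine ⟨π ^ (d / 2) / Gamma (s / 2) * (Gamma ((s + a) / 2) * K), fun x hx => ?_⟩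
  intro m
  set F : ℝ × ℝ → ℝ := fun z => z.2 ^ (s / 2 - 1) * exp (-(z.2 * ‖x‖ ^ 2)) *
    (z.1 ^ (a / 2 - 1) * truncDefect β (z.2 / z.1)) with hF
  have hFm : AEStronglyMeasurable F
      ((volume.restrict (Set.Ioi 0)).prod (volume.restrict (Set.Ioi 0))) := by
    refine Measurable.aestronglyMeasurable ?_
    fun_prop
  have hpow : ∀ u ∈ Set.Ioi (0 : ℝ), ∀ k : ℝ, u ^ (s / 2 - 1) * exp (-(u * ‖x‖ ^ 2)) *
      (u ^ (a / 2) * k) = u ^ ((s + a) / 2 - 1) * exp (-(u * ‖x‖ ^ 2)) * k := by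
    intro u hu k
    rw [show (s + a) / 2 - 1 = s / 2 - 1 + a / 2 by ring, rpow_add hu]
    ring
  have hFu : ∀ u ∈ Set.Ioi (0 : ℝ), ∫ t in Set.Ioi (0 : ℝ), F (t, u) =
      u ^ ((s + a) / 2 - 1) * exp (-(u * ‖x‖ ^ 2)) *
        (|Gamma (-(a / 2))| * Gamma β / Gamma (β - a / 2)) := by
    intro u hu
    simp only [hF]
    rw [integral_const_mul, (integrableOn_and_integral_rpow_mul_comp_div hi hu).2, hv, hpow u hu]
  have hFnu : ∀ u ∈ Set.Ioi (0 : ℝ), ∫ t in Set.Ioi (0 : ℝ), ‖F (t, u)‖ =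
      u ^ ((s + a) / 2 - 1) * exp (-(u * ‖x‖ ^ 2)) * K := by
    intro u hu
    rw [← hpow u hu, ← (integrableOn_and_integral_rpow_mul_comp_div hi' hu).2,
      ← integral_const_mul]
    refine setIntegral_congr_fun measurableSet_Ioi fun t ht => ?_
    simp only [hF]
    rw [norm_mul, norm_mul (_ ^ _) (truncDefect _ _), norm_eq_abs (truncDefect _ _),
      norm_of_nonneg (rpow_nonneg (Set.mem_Ioi.1 ht).le _),
      norm_of_nonneg (mul_nonneg (rpow_nonneg (Set.mem_Ioi.1 hu).le _) (exp_pos _).le)]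
  have hE := integrableOn_rpow_mul_exp_neg_mul_norm_sq (s := s + a) (by linarith) hx
  have hEv := integral_rpow_mul_exp_neg_mul_norm_sq (s := s + a) (by linarith) hx
  have hFi : Integrable F ((volume.restrict (Set.Ioi 0)).prod (volume.restrict (Set.Ioi 0))) := by
    refine (integrable_prod_iff' hFm).2 ⟨?_, ?_⟩
    · refine (ae_restrict_iff' measurableSet_Ioi).2 (.of_forall fun u hu => ?_)
      exact (integrableOn_and_integral_rpow_mul_comp_div hi hu).1.const_mul
        (u ^ (s / 2 - 1) * exp (-(u * ‖x‖ ^ 2)))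
    · exact IntegrableOn.congr_fun (hE.mul_const K) (fun u hu => (hFnu u hu).symm)
        measurableSet_Ioi
  have hmF : ∀ t ∈ Set.Ioi (0 : ℝ), m t = π ^ (d / 2) / Gamma (s / 2) *
      ∫ u in Set.Ioi (0 : ℝ), F (t, u) := by
    intro t ht
    have ht : 0 < t := ht
    simp only [m, hF]
    rw [(integrable_and_integral_rpow_norm_sub_mul_gaussian hs (by linarith) ht hx).2, ← hd, ← hβ,
      div_rpow pi_pos.le ht.le, show (d + a) / 2 - 1 = d / 2 + (a / 2 - 1) by ring,
      rpow_add ht]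
    have e : ∀ u : ℝ, u ^ (s / 2 - 1) * exp (-(u * ‖x‖ ^ 2)) *
        (t ^ (a / 2 - 1) * truncDefect β (u / t)) = t ^ (a / 2 - 1) *
        (u ^ (s / 2 - 1) * exp (-(u * ‖x‖ ^ 2)) * truncDefect β (u / t)) := fun u => by ring
    simp_rw [e]
    rw [integral_const_mul]
    have := rpow_pos_of_pos ht (d / 2)
    generalize ∫ u in Set.Ioi (0 : ℝ), u ^ (s / 2 - 1) * exp (-(u * ‖x‖ ^ 2)) *
      truncDefect β (u / t) = I
    field_simp
  refine ⟨IntegrableOn.congr_fun (hFi.integral_prod_left.const_mul _)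
    (fun t ht => (hmF t ht).symm) measurableSet_Ioi, ?_, ?_⟩
  · rw [setIntegral_congr_fun measurableSet_Ioi hmF, integral_const_mul,
      integral_integral_swap (f := fun t u => F (t, u)) hFi,
      setIntegral_congr_fun measurableSet_Ioi hFu, integral_mul_const, hEv, rieszFactor]
    ring
  · calc ∫ t in Set.Ioi (0 : ℝ), ‖m t‖
        ≤ ∫ t in Set.Ioi (0 : ℝ), π ^ (d / 2) / Gamma (s / 2) *
          ∫ u in Set.Ioi (0 : ℝ), ‖F (t, u)‖ := by
          refine integral_mono_of_nonneg (.of_forall fun _ => norm_nonneg _)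
            (hFi.integral_norm_prod_left.const_mul _) ?_
          refine (ae_restrict_iff' measurableSet_Ioi).2 (.of_forall fun t ht => ?_)
          simp only
          rw [hmF t ht, norm_mul, norm_of_nonneg (by positivity)]
          gcongr
          exact norm_integral_le_integral_norm _
      _ = _ := by
          rw [integral_const_mul, integral_integral_swap (f := fun t u => ‖F (t, u)‖) hFi.norm,
            setIntegral_congr_fun measurableSet_Ioi hFnu, integral_mul_const, hEv]
          ring

end RieszSubordination

section Subordination
variable {Z : Type*} [MeasurableSpace Z] {μ : Measure Z} [SFinite μ]

lemma integral_rpow_mul_mul_exp_neg_mul {p q N : ℝ} (hp : 0 < p) (hq : 0 ≤ q)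
    (hN : q = 0 → N = 0) :
    IntegrableOn (fun t : ℝ => t ^ (p - 1) * (N * exp (-(t * q)))) (Set.Ioi 0) ∧
    ∫ t in Set.Ioi (0 : ℝ), t ^ (p - 1) * (N * exp (-(t * q))) = Gamma p * (N / q ^ p) := by
  rcases hq.eq_or_lt with h | h
  · simp [hN h.symm]
  have hv := integral_rpow_mul_exp_neg_mul_Ioi hp h
  have hΓ := Gamma_pos_of_pos hp
  have hi : IntegrableOn (fun t : ℝ => t ^ (p - 1) * exp (-(q * t))) (Set.Ioi 0) := by
    refine Integrable.of_integral_ne_zero ?_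
    rw [hv]
    positivity
  simp_rw [mul_left_comm _ N, mul_comm _ q]
  refine ⟨hi.const_mul N, ?_⟩
  rw [integral_const_mul, hv, one_div, inv_rpow hq]
  ring

lemma integrable_div_rpow_iff {p : ℝ} (hp : 0 < p) {q N : Z → ℝ} (hq : Measurable q)
    (hq0 : ∀ z, 0 ≤ q z) (hN : Measurable N) (hN0 : ∀ z, q z = 0 → N z = 0) :
    Integrable (fun z => N z / q z ^ p) μ ↔
      Integrable (fun w : ℝ × Z => w.1 ^ (p - 1) * (N w.2 * exp (-(w.1 * q w.2))))
        ((volume.restrict (Set.Ioi 0)).prod μ) := by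
  have hΓ := Gamma_pos_of_pos hp
  have hm : AEStronglyMeasurable
      (fun w : ℝ × Z => w.1 ^ (p - 1) * (N w.2 * exp (-(w.1 * q w.2))))
      ((volume.restrict (Set.Ioi 0)).prod μ) := by
    refine Measurable.aestronglyMeasurable ?_
    fun_prop
  have hn : ∀ z, ∫ t in Set.Ioi (0 : ℝ), ‖t ^ (p - 1) * (N z * exp (-(t * q z)))‖ =
      Gamma p * ‖N z / q z ^ p‖ := by
    intro z
    rw [norm_div, norm_of_nonneg (rpow_nonneg (hq0 z) p),
      ← (integral_rpow_mul_mul_exp_neg_mul hp (hq0 z) (N := ‖N z‖)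
        (fun h => by simp [hN0 z h])).2]
    refine setIntegral_congr_fun measurableSet_Ioi fun t ht => ?_
    rw [norm_mul, norm_mul, norm_of_nonneg (rpow_nonneg (Set.mem_Ioi.1 ht).le _),
      norm_of_nonneg (exp_pos _).le]
  rw [integrable_prod_iff' hm]
  simp only [hn]
  rw [integrable_const_mul_iff (isUnit_iff_ne_zero.2 hΓ.ne'), integrable_norm_iff]
  · exact ⟨fun h => ⟨.of_forall fun z => (integral_rpow_mul_mul_exp_neg_mul hp (hq0 z)
      (hN0 z)).1, h⟩, fun h => h.2⟩
  · refine Measurable.aestronglyMeasurable ?_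
    fun_prop

/-- Transfer of a decomposition `N₁ = D + N₂` from Gaussian kernels `exp (-t q)` to the power
kernel `q ^ (-p)`: nonnegativity of `N₂` replaces integrability of `D / q ^ p`. -/
lemma integrable_and_integral_div_rpow_of_add {p : ℝ} (hp : 0 < p) {q N₁ N₂ D : Z → ℝ}
    (hq : Measurable q) (hq0 : ∀ z, 0 ≤ q z)
    (hN₁ : Measurable N₁) (hN₁0 : ∀ z, q z = 0 → N₁ z = 0)
    (hN₂ : Measurable N₂) (hN₂0 : ∀ z, q z = 0 → N₂ z = 0) (hN₂_nonneg : ∀ z, 0 ≤ N₂ z)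
    (hadd : ∀ᵐ z ∂μ, N₁ z = D z + N₂ z)
    (h_int : Integrable (fun z => N₁ z / q z ^ p) μ)
    (hD : ∀ t : ℝ, 0 < t → Integrable (fun z => D z * exp (-(t * q z))) μ)
    (hDt : IntegrableOn (fun t : ℝ => t ^ (p - 1) * ∫ z, D z * exp (-(t * q z)) ∂μ) (Set.Ioi 0)) :
    Integrable (fun z => N₂ z / q z ^ p) μ ∧
    Gamma p * ∫ z, N₁ z / q z ^ p ∂μ =
      (∫ t in Set.Ioi (0 : ℝ), t ^ (p - 1) * ∫ z, D z * exp (-(t * q z)) ∂μ) +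
        Gamma p * ∫ z, N₂ z / q z ^ p ∂μ := by
  have hT₁ := (integrable_div_rpow_iff hp hq hq0 hN₁ hN₁0).1 h_int
  have hae : ∀ᵐ t ∂(volume.restrict (Set.Ioi (0 : ℝ))),
      Integrable (fun z => N₂ z * exp (-(t * q z))) μ ∧
      t ^ (p - 1) * ∫ z, N₂ z * exp (-(t * q z)) ∂μ =
        (∫ z, t ^ (p - 1) * (N₁ z * exp (-(t * q z))) ∂μ) -
          t ^ (p - 1) * ∫ z, D z * exp (-(t * q z)) ∂μ := by
    filter_upwards [hT₁.prod_right_ae, ae_restrict_mem measurableSet_Ioi] with t ht ht0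
    have ht0 : 0 < t := ht0
    have hpow := (rpow_pos_of_pos ht0 (p - 1)).ne'
    rw [integrable_const_mul_iff (isUnit_iff_ne_zero.2 hpow)] at ht
    have he : ∀ᵐ z ∂μ, N₁ z * exp (-(t * q z)) - D z * exp (-(t * q z)) =
        N₂ z * exp (-(t * q z)) := by
      filter_upwards [hadd] with z hz
      rw [hz]
      ring
    refine ⟨(ht.sub (hD t ht0)).congr he, ?_⟩
    rw [← integral_congr_ae he, integral_sub ht (hD t ht0), integral_const_mul]
    ring
  have hI₂ : Integrable (fun t : ℝ => t ^ (p - 1) * ∫ z, N₂ z * exp (-(t * q z)) ∂μ)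
      (volume.restrict (Set.Ioi 0)) :=
    (hT₁.integral_prod_left.sub hDt).congr (hae.mono fun t ht => ht.2.symm)
  have hT₂ : Integrable (fun w : ℝ × Z => w.1 ^ (p - 1) * (N₂ w.2 * exp (-(w.1 * q w.2))))
        ((volume.restrict (Set.Ioi 0)).prod μ) := by
    refine (integrable_prod_iff (Measurable.aestronglyMeasurable (by fun_prop))).2
      ⟨hae.mono fun t ht => ht.1.const_mul (t ^ (p - 1)), ?_⟩
    refine IntegrableOn.congr_fun hI₂ (fun t ht => ?_) measurableSet_Ioi
    have ht : 0 < t := ht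
    simp only
    rw [← integral_const_mul]
    refine integral_congr_ae (.of_forall fun z => ?_)
    have := hN₂_nonneg z
    exact (norm_of_nonneg (by positivity)).symm
  refine ⟨(integrable_div_rpow_iff hp hq hq0 hN₂ hN₂0).2 hT₂, ?_⟩
  have swap : ∀ N : Z → ℝ, (∀ z, q z = 0 → N z = 0) →
      Integrable (fun w : ℝ × Z => w.1 ^ (p - 1) * (N w.2 * exp (-(w.1 * q w.2))))
        ((volume.restrict (Set.Ioi 0)).prod μ) →
      Gamma p * ∫ z, N z / q z ^ p ∂μ =
        ∫ t in Set.Ioi (0 : ℝ), ∫ z, t ^ (p - 1) * (N z * exp (-(t * q z))) ∂μ := by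
    intro N hN0 hT
    rw [integral_integral_swap (f := fun t z => t ^ (p - 1) * (N z * exp (-(t * q z)))) hT,
      ← integral_const_mul]
    exact integral_congr_ae (.of_forall fun z =>
      (integral_rpow_mul_mul_exp_neg_mul hp (hq0 z) (hN0 z)).2.symm)
  rw [swap N₁ hN₁0 hT₁, swap N₂ hN₂0 hT₂]
  simp only [integral_const_mul (_ ^ (p - 1)) (fun z => N₂ z * _)]
  rw [integral_congr_ae (hae.mono fun t ht => ht.2), integral_sub hT₁.integral_prod_left hDt]
  ring

end Subordination

section Pairing
variable {E : Type*} [NormedAddCommGroup E] [InnerProductSpace ℝ E] [FiniteDimensional ℝ E]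
  [MeasurableSpace E] [BorelSpace E]

lemma integrable_prod_mul_of_integral_le {X Y : Type*} [MeasurableSpace X] [MeasurableSpace Y]
    {μ : Measure X} {ν : Measure Y} [SFinite ν] {f : X → ℝ} {g : X × Y → ℝ}
    (hf : Integrable f μ) (hg : Measurable g) (hg0 : ∀ z, 0 ≤ g z)
    (hgi : ∀ x, Integrable (fun y => g (x, y)) ν) {C : ℝ} (hC : ∀ x, ∫ y, g (x, y) ∂ν ≤ C) :
    Integrable (fun z : X × Y => f z.1 * g z) (μ.prod ν) := by
  have hm : AEStronglyMeasurable (fun z : X × Y => f z.1 * g z) (μ.prod ν) :=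
    hf.1.comp_fst.mul hg.aestronglyMeasurable
  refine (integrable_prod_iff hm).2 ⟨.of_forall fun x => (hgi x).const_mul (f x), ?_⟩
  refine Integrable.mono' (hf.norm.mul_const C) hm.norm.integral_prod_right' ?_
  refine .of_forall fun x => ?_
  simp only [norm_mul, norm_of_nonneg (hg0 _)]
  rw [integral_const_mul, norm_mul, norm_norm, norm_of_nonneg (integral_nonneg fun y => hg0 _)]
  gcongr
  exact hC x

lemma exists_integral_rpow_norm_mul_gaussian_le [Nontrivial E] {s t : ℝ} (hs : 0 < s)
    (hsd : s < Module.finrank ℝ E) (ht : 0 < t) :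
    ∃ C : ℝ, ∀ x : E, ∫ y : E, ‖y‖ ^ (-s) * exp (-(t * ‖x - y‖ ^ 2)) ≤ C := by
  refine ⟨(π / t) ^ ((Module.finrank ℝ E : ℝ) / 2) / Gamma (s / 2) *
    ∫ u in Set.Ioi (0 : ℝ), u ^ (s / 2 - 1) *
      (1 - truncDefect ((Module.finrank ℝ E - s) / 2) (u / t)), fun x => ?_⟩
  have hΓ := Gamma_pos_of_pos (half_pos hs)
  rw [(integrable_and_integral_rpow_norm_mul_gaussian hs hsd ht x).2]
  refine mul_le_mul_of_nonneg_left ?_ (by positivity)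
  refine setIntegral_mono_on
    (integrableOn_rpow_mul_exp_mul_one_sub_truncDefect (by linarith) (by linarith) ht
      (sq_nonneg ‖x‖))
    (integrableOn_rpow_mul_one_sub_truncDefect (by linarith) (by linarith) ht)
    measurableSet_Ioi fun u hu => ?_
  have hu : 0 < u := hu
  have h1 := one_sub_truncDefect_nonneg ((Module.finrank ℝ E - s) / 2) (u / t)
  have h2 : exp (-(u * ‖x‖ ^ 2)) ≤ 1 := exp_le_one_iff.2 (by
    have := mul_nonneg hu.le (sq_nonneg ‖x‖)
    linarith)
  gcongr
  exact mul_le_of_le_one_right (by positivity) h2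

/-- The weak form of `(-Δ) ^ (a / 2) ‖x‖ ^ (-s) = c ‖x‖ ^ (-s - a)`, with the singular kernel
resolved into Gaussians. -/
lemma integrable_and_integral_weight_mul_rpow_norm_sub [Nontrivial E] {a s : ℝ} (ha0 : 0 < a)
    (ha2 : a < 2) (hs : 0 < s) (hsd : s + a < Module.finrank ℝ E) {W : E → ℝ} (hW : Measurable W)
    (hWi : Integrable W) (hWs : Integrable (fun x => W x * ‖x‖ ^ (-s)))
    (hWsa : Integrable (fun x => W x * ‖x‖ ^ (-(s + a)))) :
    let J : ℝ → ℝ := fun t => ∫ z : E × E, W z.1 * (‖z.1‖ ^ (-s) - ‖z.2‖ ^ (-s)) *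
      exp (-(t * ‖z.1 - z.2‖ ^ 2))
    (∀ t : ℝ, 0 < t → Integrable (fun z : E × E => W z.1 * (‖z.1‖ ^ (-s) - ‖z.2‖ ^ (-s)) *
      exp (-(t * ‖z.1 - z.2‖ ^ 2)))) ∧
    IntegrableOn (fun t : ℝ => t ^ ((Module.finrank ℝ E + a) / 2 - 1) * J t) (Set.Ioi 0) ∧
    ∫ t in Set.Ioi (0 : ℝ), t ^ ((Module.finrank ℝ E + a) / 2 - 1) * J t =
      rieszFactor (Module.finrank ℝ E) a s * ∫ x, W x * ‖x‖ ^ (-(s + a)) := by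
  intro J
  have hI : ∀ t : ℝ, 0 < t → Integrable (fun z : E × E => W z.1 *
      (‖z.1‖ ^ (-s) - ‖z.2‖ ^ (-s)) * exp (-(t * ‖z.1 - z.2‖ ^ 2))) := by
    intro t ht
    obtain ⟨C, hC⟩ := exists_integral_rpow_norm_mul_gaussian_le (E := E) hs (by linarith) ht
    have h1 := integrable_prod_mul_of_integral_le (μ := volume) (ν := (volume : Measure E)) hWs
      (g := fun z : E × E => exp (-(t * ‖z.1 - z.2‖ ^ 2))) (by fun_prop)
      (fun _ => (exp_pos _).le) (fun x => integrable_exp_neg_mul_norm_sub_sq ht x)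
      (fun x => (integral_exp_neg_mul_norm_sub_sq ht x).le)
    have h2 := integrable_prod_mul_of_integral_le (μ := volume) (ν := (volume : Measure E)) hWi
      (g := fun z : E × E => ‖z.2‖ ^ (-s) * exp (-(t * ‖z.1 - z.2‖ ^ 2))) (by fun_prop)
      (fun _ => by positivity)
      (fun x => (integrable_and_integral_rpow_norm_mul_gaussian hs (by linarith) ht x).1) hC
    refine (h1.sub h2).congr (.of_forall fun z => ?_)
    simp only [Pi.sub_apply]
    ring
  refine ⟨hI, ?_⟩
  obtain ⟨C, hC⟩ := exists_integral_norm_gaussian_mean_le (E := E) ha0 ha2 hs hsd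
  set p : ℝ := (Module.finrank ℝ E + a) / 2 - 1 with hp
  set R : ℝ × E → ℝ := fun z => W z.2 * (z.1 ^ p *
    ∫ y : E, (‖z.2‖ ^ (-s) - ‖y‖ ^ (-s)) * exp (-(z.1 * ‖z.2 - y‖ ^ 2))) with hR
  have hRm : AEStronglyMeasurable R ((volume.restrict (Set.Ioi 0)).prod volume) := by
    have h1 : StronglyMeasurable (fun w : (ℝ × E) × E => (‖w.1.2‖ ^ (-s) - ‖w.2‖ ^ (-s)) *
        exp (-(w.1.1 * ‖w.1.2 - w.2‖ ^ 2))) := by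
      refine Measurable.stronglyMeasurable ?_
      fun_prop
    have h2 := (h1.integral_prod_right' (ν := (volume : Measure E))).measurable
    refine Measurable.aestronglyMeasurable ?_
    simp only [hR]
    fun_prop
  have hne : ∀ᵐ x : E, x ≠ 0 := compl_mem_ae_iff.2 (measure_singleton (0 : E))
  have hRi : Integrable R ((volume.restrict (Set.Ioi 0)).prod volume) := by
    refine (integrable_prod_iff' hRm).2 ⟨?_, ?_⟩
    · filter_upwards [hne] with x hx
      exact (hC x hx).1.const_mul (W x)
    · refine Integrable.mono' (hWsa.norm.mul_const C) hRm.norm.prod_swap.integral_prod_right' ?_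
      filter_upwards [hne] with x hx
      rw [norm_of_nonneg (integral_nonneg fun _ => norm_nonneg _)]
      simp only [hR]
      simp_rw [norm_mul (W x)]
      rw [integral_const_mul, mul_assoc]
      refine mul_le_mul_of_nonneg_left ?_ (norm_nonneg _)
      rw [norm_of_nonneg (by positivity), mul_comm _ C]
      exact (hC x hx).2.2
  have hJ : ∀ t ∈ Set.Ioi (0 : ℝ), t ^ p * J t = ∫ x, R (t, x) := by
    intro t ht
    simp only [J, hR]
    rw [Measure.volume_eq_prod, integral_prod _ (hI t ht), ← integral_const_mul]
    refine integral_congr_ae (.of_forall fun x => ?_)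
    simp only [mul_assoc]
    rw [integral_const_mul]
    ring
  refine ⟨IntegrableOn.congr_fun hRi.integral_prod_left (fun t ht => (hJ t ht).symm)
    measurableSet_Ioi, ?_⟩
  rw [setIntegral_congr_fun measurableSet_Ioi hJ,
    integral_integral_swap (f := fun t x => R (t, x)) hRi, ← integral_const_mul]
  refine integral_congr_ae ?_
  filter_upwards [hne] with x hx
  simp only [hR]
  rw [integral_const_mul, (hC x hx).2.1]
  ring

end Pairing

lemma abs_rpow_sub_rpow_le {b r s : ℝ} (hb : 0 < b) (hr : 0 ≤ r) (hs : 0 ≤ s) :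
    |r ^ b - s ^ b| ≤ max 1 b * (r ^ (b - 1) + s ^ (b - 1)) * |r - s| := by
  wlog h : s ≤ r generalizing r s
  · have := this hs hr (le_of_not_ge h)
    rwa [abs_sub_comm, add_comm, abs_sub_comm s] at this
  rcases hr.eq_or_lt with rfl | hr0
  · have : s = 0 := le_antisymm h hs
    simp [this]
  have hle : s ^ b ≤ r ^ b := rpow_le_rpow hs h hb.le
  rw [abs_of_nonneg (by linarith), abs_of_nonneg (by linarith)]
  have h1 := one_sub_one_sub_rpow_le (β := b) (v := 1 - s / r) hb
    (by linarith [(div_le_one hr0).2 h]) (by linarith [div_nonneg hs hr])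
  rw [sub_sub_cancel, div_rpow hs hr] at h1
  have hrb := rpow_pos_of_pos hr0 b
  calc r ^ b - s ^ b = r ^ b * (1 - s ^ b / r ^ b) := by field_simp
    _ ≤ r ^ b * (max 1 b * (1 - s / r)) := by gcongr
    _ = max 1 b * (r ^ (b - 1)) * (r - s) := by
      rw [rpow_sub_one hr0.ne']; field_simp
    _ ≤ _ := by
      have := rpow_nonneg hs (b - 1)
      have h2 : 0 ≤ r - s := by linarith
      gcongr
      linarith

section Integrability
variable {E : Type*} [NormedAddCommGroup E] [InnerProductSpace ℝ E] [FiniteDimensional ℝ E]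
  [MeasurableSpace E] [BorelSpace E] [Nontrivial E]

lemma integrableOn_closedBall_norm_rpow {e : ℝ} (he : -(Module.finrank ℝ E : ℝ) < e) (R : ℝ) :
    IntegrableOn (fun x : E => ‖x‖ ^ e) (Metric.closedBall 0 R) := by
  rw [← integrable_indicator_iff measurableSet_closedBall]
  have h := integrable_fun_norm_addHaar (E := E) volume
    (f := (Set.Iic R).indicator (fun r : ℝ => r ^ e))
  have he' : (fun x : E => (Set.Iic R).indicator (fun r : ℝ => r ^ e) ‖x‖) =
      (Metric.closedBall (0 : E) R).indicator (fun x => ‖x‖ ^ e) := by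
    ext x
    simp only [Set.indicator, Set.mem_Iic, mem_closedBall_zero_iff]
  rw [← he', h]
  have hd : 0 < Module.finrank ℝ E := Module.finrank_pos
  have h1 : IntegrableOn (fun r : ℝ => r ^ ((Module.finrank ℝ E : ℝ) - 1 + e)) (Set.Ioc 0 R) := by
    rcases le_total R 0 with hR | hR
    · simp [Set.Ioc_eq_empty (not_lt.2 hR)]
    · have := intervalIntegral.intervalIntegrable_rpow' (a := 0) (b := R)
        (r := (Module.finrank ℝ E : ℝ) - 1 + e) (by linarith)
      rwa [intervalIntegrable_iff_integrableOn_Ioc_of_le hR] at this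
  rw [← integrable_indicator_iff measurableSet_Ioc] at h1
  refine (h1.integrableOn (s := Set.Ioi 0)).congr_fun (fun r hr => ?_) measurableSet_Ioi
  have hr : 0 < r := hr
  by_cases hrR : r ≤ R
  · simp only [Set.indicator_of_mem (show r ∈ Set.Ioc 0 R from ⟨hr, hrR⟩),
      Set.indicator_of_mem (show r ∈ Set.Iic R from hrR), smul_eq_mul]
    rw [rpow_add hr, ← rpow_natCast, Nat.cast_sub hd, Nat.cast_one]
  · simp [hrR]

lemma integrable_min_one_sq_div_rpow {a : ℝ} (ha0 : 0 < a) (ha2 : a < 2) :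
    Integrable (fun x : E => min 1 (‖x‖ ^ 2) / ‖x‖ ^ ((Module.finrank ℝ E : ℝ) + a)) := by
  rw [integrable_fun_norm_addHaar volume
    (f := fun r : ℝ => min 1 (r ^ 2) / r ^ ((Module.finrank ℝ E : ℝ) + a)),
    ← Set.Ioc_union_Ioi_eq_Ioi zero_le_one]
  have hd : 0 < Module.finrank ℝ E := Module.finrank_pos
  have h1 : IntegrableOn (fun r : ℝ => r ^ (1 - a)) (Set.Ioc 0 1) := by
    have := intervalIntegral.intervalIntegrable_rpow' (a := 0) (b := 1)
      (r := 1 - a) (by linarith)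
    rwa [intervalIntegrable_iff_integrableOn_Ioc_of_le zero_le_one] at this
  have h2 := integrableOn_Ioi_rpow_of_lt (a := -1 - a) (by linarith) one_pos
  have hpow : ∀ r : ℝ, 0 < r → ∀ e : ℝ, r ^ (Module.finrank ℝ E - 1) *
      (r ^ e / r ^ ((Module.finrank ℝ E : ℝ) + a)) = r ^ (e - 1 - a) := by
    intro r hr e
    rw [← rpow_natCast, Nat.cast_sub hd, Nat.cast_one, ← rpow_sub hr, ← rpow_add hr]
    ring_nf
  refine (h1.congr_fun (fun r hr => ?_) measurableSet_Ioc).union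
    (h2.congr_fun (fun r hr => ?_) measurableSet_Ioi)
  · have : r ^ 2 ≤ 1 := pow_le_one₀ hr.1.le hr.2
    simp only [smul_eq_mul, min_eq_right this]
    rw [← rpow_natCast r 2, hpow r hr.1]
    norm_num
  · have hr : 1 < r := hr
    have : 1 ≤ r ^ 2 := one_le_pow₀ hr.le
    have h0 := hpow r (by linarith) 0
    rw [rpow_zero] at h0
    simp only [smul_eq_mul, min_eq_left this, h0, zero_sub]

lemma integrable_prod_min_one_sq_div_rpow {a : ℝ} (ha0 : 0 < a) (ha2 : a < 2) {w : E → ℝ}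
    (hw : Integrable w) :
    Integrable (fun z : E × E => (w z.1 + w z.2) * (min 1 (‖z.1 - z.2‖ ^ 2) /
      ‖z.1 - z.2‖ ^ ((Module.finrank ℝ E : ℝ) + a))) := by
  have hκ := integrable_min_one_sq_div_rpow (E := E) ha0 ha2
  have h1 := integrable_prod_mul_of_integral_le (μ := volume) (ν := (volume : Measure E)) hw
    (g := fun z : E × E => min 1 (‖z.1 - z.2‖ ^ 2) /
      ‖z.1 - z.2‖ ^ ((Module.finrank ℝ E : ℝ) + a)) (by fun_prop)
    (fun z => by positivity) (fun x => by simpa using hκ.comp_sub_left x)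
    (fun x => (integral_sub_left_eq_self (fun y : E => min 1 (‖y‖ ^ 2) /
      ‖y‖ ^ ((Module.finrank ℝ E : ℝ) + a)) volume x).le)
  refine (h1.add h1.swap).congr (.of_forall fun z => ?_)
  simp only [Pi.add_apply, Function.comp, Prod.fst_swap, Prod.snd_swap, norm_sub_rev z.2]
  ring

lemma integrable_norm_rpow_mul_norm_sq {e : ℝ} (he : -(Module.finrank ℝ E : ℝ) < e) {ψ : E → ℂ}
    (hψ : Continuous ψ) (hsupp : HasCompactSupport ψ) :
    Integrable (fun x : E => ‖x‖ ^ e * ‖ψ x‖ ^ 2) := by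
  obtain ⟨M, hM⟩ := hψ.bounded_above_of_compact_support hsupp
  obtain ⟨R, hR⟩ := hsupp.isBounded.subset_closedBall 0
  have h1 := (integrableOn_closedBall_norm_rpow he R).mul_const (M ^ 2)
  rw [← IntegrableOn, ← integrable_indicator_iff measurableSet_closedBall] at h1
  have hm := hψ.measurable
  refine h1.mono' (Measurable.aestronglyMeasurable (by fun_prop)) (.of_forall fun x => ?_)
  rw [norm_of_nonneg (by positivity)]
  by_cases hx : x ∈ Metric.closedBall (0 : E) R
  · rw [Set.indicator_of_mem hx]
    have := hM x
    gcongr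
  · rw [Set.indicator_of_notMem hx, image_eq_zero_of_notMem_tsupport fun h => hx (hR h)]
    simp

lemma integrable_kernel_form {a b : ℝ} (ha0 : 0 < a) (ha2 : a < 2) (hb : 0 < b) {ψ : E → ℂ}
    (hψ : ContDiff ℝ (⊤ : ℕ∞) ψ) (hsupp : HasCompactSupport ψ) :
    Integrable (fun z : E × E => (((starRingEnd ℂ) (ψ z.1) - (starRingEnd ℂ) (ψ z.2)) *
      ((‖z.1‖ ^ b : ℝ) • ψ z.1 - (‖z.2‖ ^ b : ℝ) • ψ z.2)) /
        (Complex.ofReal (‖z.1 - z.2‖ ^ ((Module.finrank ℝ E : ℝ) + a)))) := by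
  obtain ⟨M, hM⟩ := hψ.continuous.bounded_above_of_compact_support hsupp
  obtain ⟨L, hL⟩ := hψ.lipschitzWith_of_hasCompactSupport hsupp (by simp)
  obtain ⟨R', hR'⟩ := hsupp.isBounded.subset_closedBall 0
  set R := max R' 0
  have hR0 : 0 ≤ R := le_max_right _ _
  have hR : ∀ x : E, R < ‖x‖ → ψ x = 0 := fun x hx =>
    image_eq_zero_of_notMem_tsupport fun h => by
      have := hR' h
      rw [mem_closedBall_zero_iff] at this
      exact absurd (this.trans (le_max_left R' 0)) (not_le.2 hx)
  have hM0 : 0 ≤ M := (norm_nonneg _).trans (hM 0)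
  have hd : (1 : ℝ) ≤ Module.finrank ℝ E := by exact_mod_cast Module.finrank_pos (R := ℝ) (M := E)
  set w : E → ℝ := (Metric.closedBall (0 : E) (R + 1)).indicator (fun x => 1 + ‖x‖ ^ (b - 1))
  have hwi : Integrable w := by
    rw [integrable_indicator_iff measurableSet_closedBall]
    exact (integrableOn_const (measure_closedBall_lt_top.ne)).add
      (integrableOn_closedBall_norm_rpow (by linarith) _)
  have hw0 : ∀ x, 0 ≤ w x := fun x => Set.indicator_nonneg (fun x _ => by positivity) x
  have hw1 : ∀ x : E, ‖x‖ ≤ R + 1 → w x = 1 + ‖x‖ ^ (b - 1) := fun x hx =>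
    Set.indicator_of_mem (mem_closedBall_zero_iff.2 hx) _
  set C₁ : ℝ := (R + 1) ^ b * L + M * max 1 b
  set C : ℝ := 2 * M * (R ^ b * M) + L * C₁
  have hC₁ : 0 ≤ C₁ := by positivity
  have hbψ : ∀ x : E, ‖(‖x‖ ^ b : ℝ) • ψ x‖ ≤ R ^ b * M * w x := by
    intro x
    rcases le_or_gt ‖x‖ R with h | h
    · rw [norm_smul, norm_of_nonneg (by positivity), hw1 x (by linarith)]
      have h1 : (1 : ℝ) ≤ 1 + ‖x‖ ^ (b - 1) := by
        linarith [rpow_nonneg (norm_nonneg x) (b - 1)]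
      have h2 := hM x
      calc ‖x‖ ^ b * ‖ψ x‖ ≤ R ^ b * M := by gcongr
        _ ≤ _ := le_mul_of_one_le_right (by positivity) h1
    · rw [hR x h, smul_zero, norm_zero]
      have := hw0 x
      positivity
  have hbound : ∀ x y : E, ‖((starRingEnd ℂ) (ψ x) - (starRingEnd ℂ) (ψ y)) *
      ((‖x‖ ^ b : ℝ) • ψ x - (‖y‖ ^ b : ℝ) • ψ y)‖ ≤
        C * ((w x + w y) * min 1 (‖x - y‖ ^ 2)) := by
    intro x y
    have hwx := hw0 x
    have hwy := hw0 y
    rw [norm_mul, ← map_sub, RCLike.norm_conj]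
    rcases le_or_gt 1 ‖x - y‖ with h | h
    · rw [min_eq_left (one_le_pow₀ h), mul_one]
      have h1 : ‖ψ x - ψ y‖ ≤ 2 * M := (norm_sub_le _ _).trans (by linarith [hM x, hM y])
      have h2 : ‖(‖x‖ ^ b : ℝ) • ψ x - (‖y‖ ^ b : ℝ) • ψ y‖ ≤ R ^ b * M * (w x + w y) :=
        (norm_sub_le _ _).trans (by linarith [hbψ x, hbψ y])
      calc _ ≤ 2 * M * (R ^ b * M * (w x + w y)) := by gcongr
        _ = 2 * M * (R ^ b * M) * (w x + w y) := by ring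
        _ ≤ _ := by
          gcongr
          exact le_add_of_nonneg_right (by positivity)
    · rw [min_eq_right (pow_le_one₀ (norm_nonneg _) h.le)]
      by_cases hxy : ‖x‖ ≤ R + 1 ∧ ‖y‖ ≤ R + 1
      · have h1 : ‖ψ x - ψ y‖ ≤ L * ‖x - y‖ := hL.norm_sub_le x y
        have e : (‖x‖ ^ b : ℝ) • ψ x - (‖y‖ ^ b : ℝ) • ψ y =
            (‖x‖ ^ b : ℝ) • (ψ x - ψ y) + (‖x‖ ^ b - ‖y‖ ^ b : ℝ) • ψ y := by
          rw [smul_sub, sub_smul]; abel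
        have hx0 := rpow_nonneg (norm_nonneg x) (b - 1)
        have hy0 := rpow_nonneg (norm_nonneg y) (b - 1)
        have h2 : ‖(‖x‖ ^ b : ℝ) • ψ x - (‖y‖ ^ b : ℝ) • ψ y‖ ≤
            C₁ * (w x + w y) * ‖x - y‖ := by
          rw [e]
          refine (norm_add_le _ _).trans ?_
          rw [norm_smul, norm_smul, norm_of_nonneg (by positivity), norm_eq_abs]
          have h3 := abs_rpow_sub_rpow_le hb (norm_nonneg x) (norm_nonneg y)
          have h4 := abs_norm_sub_norm_le x y
          have h5 := hM y
          have h6 := hxy.1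
          rw [hw1 x hxy.1, hw1 y hxy.2]
          calc _ ≤ (R + 1) ^ b * (L * ‖x - y‖) +
                max 1 b * (‖x‖ ^ (b - 1) + ‖y‖ ^ (b - 1)) * ‖x - y‖ * M := by
                gcongr
                exact h3.trans (by gcongr)
            _ = ((R + 1) ^ b * L * 1 +
                M * max 1 b * (‖x‖ ^ (b - 1) + ‖y‖ ^ (b - 1))) * ‖x - y‖ := by ring
            _ ≤ ((R + 1) ^ b * L * (1 + ‖x‖ ^ (b - 1) + (1 + ‖y‖ ^ (b - 1))) +
                M * max 1 b * (1 + ‖x‖ ^ (b - 1) + (1 + ‖y‖ ^ (b - 1)))) * ‖x - y‖ := by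
                gcongr <;> linarith
            _ = _ := by ring
        calc _ ≤ L * ‖x - y‖ * (C₁ * (w x + w y) * ‖x - y‖) := by gcongr
          _ = L * C₁ * ((w x + w y) * ‖x - y‖ ^ 2) := by ring
          _ ≤ _ := by
            gcongr
            exact le_add_of_nonneg_left (by positivity)
      · have hz : ψ x = 0 ∧ ψ y = 0 := by
          have h1 : ‖x‖ ≤ ‖y‖ + ‖x - y‖ := norm_le_norm_add_norm_sub' x y
          have h2 : ‖y‖ ≤ ‖x‖ + ‖x - y‖ := norm_le_norm_add_norm_sub x y
          rw [not_and_or, not_le, not_le] at hxy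
          constructor <;> apply hR <;> rcases hxy with h' | h' <;> linarith
        rw [hz.1, hz.2]
        simp only [sub_self, norm_zero, zero_mul]
        positivity
  refine ((integrable_prod_min_one_sq_div_rpow ha0 ha2 hwi).const_mul C).mono' ?_
    (.of_forall fun z => ?_)
  · have hm := hψ.continuous.measurable
    have hc : Measurable (starRingEnd ℂ) := Complex.continuous_conj.measurable
    refine Measurable.aestronglyMeasurable ?_
    fun_prop
  · rw [norm_div, Complex.norm_real, norm_of_nonneg (by positivity), ← mul_div_assoc,
      ← mul_div_assoc]
    gcongr
    exact hbound z.1 z.2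

end Integrability

lemma re_conj_sub_mul_sub_eq {P Q : ℝ} (hP : P ≠ 0) (hQ : Q ≠ 0) (A B : ℝ) (u v : ℂ) :
    (((starRingEnd ℂ) u - (starRingEnd ℂ) v) * (A • u - B • v)).re =
      (P * A * ‖u‖ ^ 2 * (P⁻¹ - Q⁻¹) + P * ‖u‖ ^ 2 * (A * P⁻¹ - B * Q⁻¹)) / 2 +
      (Q * B * ‖v‖ ^ 2 * (Q⁻¹ - P⁻¹) + Q * ‖v‖ ^ 2 * (B * Q⁻¹ - A * P⁻¹)) / 2 +
      (A + B) * ‖P • u - Q • v‖ ^ 2 / (2 * P * Q) := by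
  simp only [Complex.sq_norm, Complex.normSq_apply, Complex.mul_re, Complex.sub_re,
    Complex.sub_im, Complex.conj_re, Complex.conj_im, Complex.smul_re, Complex.smul_im,
    smul_eq_mul]
  field_simp
  ring

lemma alphaConst_mul_rieszFactor {n : ℕ} {a b : ℝ} (ha : a ∈ Set.Ioo (0 : ℝ) 2) :
    alphaConst n a * (rieszFactor n a (((n : ℝ) + b - a) / 2) +
      rieszFactor n a (((n : ℝ) + b - a) / 2 - b)) =
      Gamma (((n : ℝ) + a) / 2) * LConst n a b := by
  have h0 : Gamma (-a / 2) ≠ 0 := Gamma_ne_zero fun m hm => by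
    rcases m with _ | m
    · push_cast at hm
      linarith [ha.1]
    · push_cast at hm
      have := ha.2
      have : (0 : ℝ) ≤ m := m.cast_nonneg
      linarith
  have h1 : |Gamma (-a / 2)| ≠ 0 := abs_ne_zero.2 h0
  have hπ : π ^ (-(n : ℝ) / 2) * π ^ ((n : ℝ) / 2) = 1 := by
    rw [← rpow_add pi_pos, neg_div, neg_add_cancel, rpow_zero]
  have h2 : (2 : ℝ) ^ (a - 1) = 2 ^ a / 2 := rpow_sub_one two_ne_zero a
  unfold alphaConst LConst rieszFactor
  rw [show -(a / 2) = -a / 2 by ring, h2,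
    show (((n : ℝ) + b - a) / 2) / 2 = (n + b - a) / 4 by ring,
    show (((n : ℝ) + b - a) / 2 + a) / 2 = (n + b + a) / 4 by ring,
    show ((n : ℝ) - ((n : ℝ) + b - a) / 2) / 2 = (n - b + a) / 4 by ring,
    show ((n : ℝ) - b + a) / 4 - a / 2 = (n - b - a) / 4 by ring,
    show (((n : ℝ) + b - a) / 2 - b) / 2 = (n - b - a) / 4 by ring,
    show (((n : ℝ) + b - a) / 2 - b + a) / 2 = (n - b + a) / 4 by ring,
    show ((n : ℝ) - (((n : ℝ) + b - a) / 2 - b)) / 2 = (n + b + a) / 4 by ring,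
    show ((n : ℝ) + b + a) / 4 - a / 2 = (n + b - a) / 4 by ring]
  set G₁ := Gamma (((n : ℝ) + b - a) / 4)
  set G₂ := Gamma (((n : ℝ) - b - a) / 4)
  set T := |Gamma (-a / 2)|
  calc _ = (π ^ (-(n : ℝ) / 2) * π ^ ((n : ℝ) / 2)) * (T * T⁻¹) *
        (2 ^ a * Gamma (((n : ℝ) + a) / 2) * Gamma (((n : ℝ) - b + a) / 4) *
          Gamma (((n : ℝ) + b + a) / 4) * (G₁⁻¹ * G₂⁻¹)) := by
        simp only [div_eq_mul_inv]
        ring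
    _ = _ := by
        rw [hπ, mul_inv_cancel₀ h1]
        simp only [div_eq_mul_inv, mul_inv]
        ring

section GroundState
variable {E : Type*} [NormedAddCommGroup E] [InnerProductSpace ℝ E] [FiniteDimensional ℝ E]
  [MeasurableSpace E] [BorelSpace E] [Nontrivial E]

lemma ae_prod_ne_zero : ∀ᵐ z : E × E, z.1 ≠ 0 ∧ z.2 ≠ 0 := by
  have hne : ∀ᵐ x : E, x ≠ 0 := compl_mem_ae_iff.2 (measure_singleton (0 : E))
  exact (Measure.quasiMeasurePreserving_fst.ae hne).and (Measure.quasiMeasurePreserving_snd.ae hne)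

/-- The ground state representation up to the normalising constants. -/
lemma integrable_and_integral_ground_state {a b γ : ℝ} (ha0 : 0 < a) (ha2 : a < 2) (hb : 0 < b)
    (hab : a + b < Module.finrank ℝ E) (hγ : γ = ((Module.finrank ℝ E : ℝ) + b - a) / 2)
    {ψ : E → ℂ} (hψ : ContDiff ℝ (⊤ : ℕ∞) ψ) (hsupp : HasCompactSupport ψ) :
    let p : ℝ := ((Module.finrank ℝ E : ℝ) + a) / 2
    let N₁ : E × E → ℝ := fun z => (((starRingEnd ℂ) (ψ z.1) - (starRingEnd ℂ) (ψ z.2)) *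
      ((‖z.1‖ ^ b : ℝ) • ψ z.1 - (‖z.2‖ ^ b : ℝ) • ψ z.2)).re
    let N₂ : E × E → ℝ := fun z => (‖z.1‖ ^ b + ‖z.2‖ ^ b) *
      ‖(‖z.1‖ ^ γ : ℝ) • ψ z.1 - (‖z.2‖ ^ γ : ℝ) • ψ z.2‖ ^ 2 / (2 * ‖z.1‖ ^ γ * ‖z.2‖ ^ γ)
    Integrable (fun z : E × E => N₂ z / ‖z.1 - z.2‖ ^ ((Module.finrank ℝ E : ℝ) + a)) ∧
    Gamma p * ∫ z : E × E, N₁ z / ‖z.1 - z.2‖ ^ ((Module.finrank ℝ E : ℝ) + a) =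
      (rieszFactor (Module.finrank ℝ E) a γ + rieszFactor (Module.finrank ℝ E) a (γ - b)) *
        (∫ x : E, ‖x‖ ^ (b - a) * ‖ψ x‖ ^ 2) +
      Gamma p * ∫ z : E × E, N₂ z / ‖z.1 - z.2‖ ^ ((Module.finrank ℝ E : ℝ) + a) := by
  intro p N₁ N₂
  have hd : (1 : ℝ) ≤ Module.finrank ℝ E := by exact_mod_cast Module.finrank_pos (R := ℝ) (M := E)
  have hψm := hψ.continuous.measurable
  have hc : Measurable (starRingEnd ℂ) := Complex.continuous_conj.measurable
  have hne : ∀ᵐ x : E, x ≠ 0 := compl_mem_ae_iff.2 (measure_singleton (0 : E))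
  have h_int : ∀ {e e' : ℝ}, -(Module.finrank ℝ E : ℝ) < e + e' →
      Integrable (fun x : E => ‖x‖ ^ e * ‖ψ x‖ ^ 2 * ‖x‖ ^ e') := by
    intro e e' he
    refine (integrable_norm_rpow_mul_norm_sq he hψ.continuous hsupp).congr ?_
    filter_upwards [hne] with x hx
    rw [rpow_add (norm_pos_iff.2 hx)]
    ring
  have hwt : ∀ {e s : ℝ}, e - (s + a) = b - a →
      ∫ x : E, ‖x‖ ^ e * ‖ψ x‖ ^ 2 * ‖x‖ ^ (-(s + a)) =
        ∫ x : E, ‖x‖ ^ (b - a) * ‖ψ x‖ ^ 2 := by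
    intro e s he
    refine integral_congr_ae ?_
    filter_upwards [hne] with x hx
    rw [← he, sub_eq_add_neg, rpow_add (norm_pos_iff.2 hx)]
    ring
  obtain ⟨hJ₁, hJ₁t, hJ₁v⟩ := integrable_and_integral_weight_mul_rpow_norm_sub (E := E) ha0 ha2
    (s := γ) (by linarith) (by linarith) (W := fun x => ‖x‖ ^ (γ + b) * ‖ψ x‖ ^ 2) (by fun_prop)
    (integrable_norm_rpow_mul_norm_sq (by linarith) hψ.continuous hsupp) (h_int (by linarith))
    (h_int (by linarith))
  obtain ⟨hJ₂, hJ₂t, hJ₂v⟩ := integrable_and_integral_weight_mul_rpow_norm_sub (E := E) ha0 ha2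
    (s := γ - b) (by linarith) (by linarith) (W := fun x => ‖x‖ ^ γ * ‖ψ x‖ ^ 2) (by fun_prop)
    (integrable_norm_rpow_mul_norm_sq (by linarith) hψ.continuous hsupp) (h_int (by linarith))
    (h_int (by linarith))
  rw [hwt (by ring)] at hJ₁v hJ₂v
  set G : E × E → ℝ := fun z =>
    (‖z.1‖ ^ (γ + b) * ‖ψ z.1‖ ^ 2 * (‖z.1‖ ^ (-γ) - ‖z.2‖ ^ (-γ)) +
      ‖z.1‖ ^ γ * ‖ψ z.1‖ ^ 2 * (‖z.1‖ ^ (-(γ - b)) - ‖z.2‖ ^ (-(γ - b)))) / 2 with hG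
  have hGi : ∀ t : ℝ, 0 < t →
      Integrable (fun z : E × E => G z * exp (-(t * ‖z.1 - z.2‖ ^ 2))) := by
    intro t ht
    refine (((hJ₁ t ht).add (hJ₂ t ht)).div_const 2).congr (.of_forall fun z => ?_)
    simp only [Pi.add_apply, hG]
    ring
  have hGs : ∀ t : ℝ, 0 < t →
      Integrable (fun z : E × E => G z.swap * exp (-(t * ‖z.1 - z.2‖ ^ 2))) := by
    intro t ht
    refine (hGi t ht).swap.congr (.of_forall fun z => ?_)
    simp only [Function.comp, Prod.fst_swap, Prod.snd_swap, norm_sub_rev z.2]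
  have hDv : ∀ t : ℝ, 0 < t →
      ∫ z : E × E, (G z + G z.swap) * exp (-(t * ‖z.1 - z.2‖ ^ 2)) =
      (∫ z : E × E, ‖z.1‖ ^ (γ + b) * ‖ψ z.1‖ ^ 2 * (‖z.1‖ ^ (-γ) - ‖z.2‖ ^ (-γ)) *
        exp (-(t * ‖z.1 - z.2‖ ^ 2))) +
      ∫ z : E × E, ‖z.1‖ ^ γ * ‖ψ z.1‖ ^ 2 * (‖z.1‖ ^ (-(γ - b)) - ‖z.2‖ ^ (-(γ - b))) *
        exp (-(t * ‖z.1 - z.2‖ ^ 2)) := by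
    intro t ht
    have hsw : ∫ z : E × E, G z.swap * exp (-(t * ‖z.1 - z.2‖ ^ 2)) =
        ∫ z : E × E, G z * exp (-(t * ‖z.1 - z.2‖ ^ 2)) := by
      rw [Measure.volume_eq_prod, ← integral_prod_swap (fun z : E × E =>
        G z * exp (-(t * ‖z.1 - z.2‖ ^ 2)))]
      simp only [Prod.fst_swap, Prod.snd_swap, norm_sub_rev]
    simp only [add_mul]
    rw [integral_add (hGi t ht) (hGs t ht), hsw, ← two_mul, ← integral_const_mul,
      ← integral_add (hJ₁ t ht) (hJ₂ t ht)]
    refine integral_congr_ae (.of_forall fun z => ?_)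
    simp only [hG]
    ring
  have hq : ∀ z : E × E, (‖z.1 - z.2‖ ^ 2) ^ p = ‖z.1 - z.2‖ ^ ((Module.finrank ℝ E : ℝ) + a) := by
    intro z
    rw [← rpow_natCast, ← rpow_mul (norm_nonneg _)]
    congr 1
    simp only [p]
    push_cast
    ring
  have hdiag : ∀ z : E × E, ‖z.1 - z.2‖ ^ 2 = 0 → z.1 = z.2 := fun z hz =>
    sub_eq_zero.1 (norm_eq_zero.1 (pow_eq_zero_iff two_ne_zero |>.1 hz))
  have hDt : ∀ t ∈ Set.Ioi (0 : ℝ), _ = t ^ (p - 1) *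
      ∫ z : E × E, (G z + G z.swap) * exp (-(t * ‖z.1 - z.2‖ ^ 2)) := fun t ht => by
    rw [hDv t ht, mul_add]
  have key := integrable_and_integral_div_rpow_of_add (μ := (volume : Measure (E × E)))
    (p := p) (by simp only [p]; positivity) (q := fun z => ‖z.1 - z.2‖ ^ 2) (N₁ := N₁) (N₂ := N₂)
    (D := fun z => G z + G z.swap) (by fun_prop) (fun z => by positivity) (by fun_prop)
    (fun z hz => by simp [N₁, hdiag z hz]) (by fun_prop) (fun z hz => by simp [N₂, hdiag z hz])
    (fun z => by positivity) ?_ ?_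
    (fun t ht => ((hGi t ht).add (hGs t ht)).congr (.of_forall fun z => (add_mul _ _ _).symm))
    (IntegrableOn.congr_fun (hJ₁t.add hJ₂t) hDt measurableSet_Ioi)
  · simp only [hq] at key
    refine ⟨key.1, key.2.trans ?_⟩
    rw [← setIntegral_congr_fun measurableSet_Ioi hDt, integral_add hJ₁t hJ₂t, hJ₁v, hJ₂v,
      add_mul]
  · filter_upwards [ae_prod_ne_zero (E := E)] with z hz
    have h1 := norm_pos_iff.2 hz.1
    have h2 := norm_pos_iff.2 hz.2
    simp only [N₁, N₂, hG, Prod.fst_swap, Prod.snd_swap]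
    rw [re_conj_sub_mul_sub_eq (rpow_pos_of_pos h1 γ).ne' (rpow_pos_of_pos h2 γ).ne']
    simp only [neg_sub, sub_eq_add_neg b γ, rpow_add h1, rpow_add h2, rpow_neg h1.le,
      rpow_neg h2.le]
  · refine (integrable_kernel_form ha0 ha2 hb hψ hsupp).re.congr (.of_forall fun z => ?_)
    simp only [hq, N₁]
    exact Complex.div_ofReal_re _ _

end GroundState

/-- Ground state representation of the kernel form of the Jordan product. -/
theorem kernel_ground_state_representation
    (n : ℕ) (hn : 0 < n) (a b : ℝ) (ha : a ∈ Set.Ioo (0 : ℝ) 2) (hb : 0 < b)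
    (hab : a + b < (n : ℝ)) (γ : ℝ) (hγ : γ = ((n : ℝ) + b - a) / 2)
    (ψ : EuclideanSpace ℝ (Fin n) → ℂ)
    (hsmooth : ContDiff ℝ (⊤ : ℕ∞) ψ) (hsupp : HasCompactSupport ψ) :
    alphaConst n a *
        (∫ x : EuclideanSpace ℝ (Fin n), ∫ y : EuclideanSpace ℝ (Fin n),
            (((starRingEnd ℂ) (ψ x) - (starRingEnd ℂ) (ψ y)) *
              ((‖x‖ ^ b : ℝ) • ψ x - (‖y‖ ^ b : ℝ) • ψ y)) /
              (Complex.ofReal (‖x - y‖ ^ ((n : ℝ) + a)))).re =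
      LConst n a b * (∫ x : EuclideanSpace ℝ (Fin n), ‖x‖ ^ (b - a) * ‖ψ x‖ ^ 2) +
        alphaConst n a *
          ∫ x : EuclideanSpace ℝ (Fin n), ∫ y : EuclideanSpace ℝ (Fin n),
            (‖x‖ ^ b + ‖y‖ ^ b) *
              ‖(‖x‖ ^ γ : ℝ) • ψ x - (‖y‖ ^ γ : ℝ) • ψ y‖ ^ 2 /
              (2 * ‖x‖ ^ γ * ‖x - y‖ ^ ((n : ℝ) + a) * ‖y‖ ^ γ) := by
  have hdim : Module.finrank ℝ (EuclideanSpace ℝ (Fin n)) = n := finrank_euclideanSpace_fin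
  have : Nontrivial (EuclideanSpace ℝ (Fin n)) :=
    Module.nontrivial_of_finrank_pos (R := ℝ) (by rwa [hdim])
  have hk := integrable_kernel_form (E := EuclideanSpace ℝ (Fin n)) ha.1 ha.2 hb hsmooth hsupp
  have hg := integrable_and_integral_ground_state (E := EuclideanSpace ℝ (Fin n)) ha.1 ha.2 hb
    (γ := γ) (by rwa [hdim]) (by rwa [hdim]) hsmooth hsupp
  rw [hdim] at hk hg
  obtain ⟨hi, hv⟩ := hg
  have hΓ : 0 < Gamma (((n : ℝ) + a) / 2) := Gamma_pos_of_pos (by have := ha.1; positivity)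
  have hre := integral_prod _ hk
  have hn2 := integral_prod _ hi
  rw [← hre, ← Measure.volume_eq_prod, ← RCLike.re_eq_complex_re, ← integral_re hk]
  simp only [RCLike.re_eq_complex_re, Complex.div_ofReal_re]
  have hperm : ∀ x y : EuclideanSpace ℝ (Fin n), (‖x‖ ^ b + ‖y‖ ^ b) *
      ‖(‖x‖ ^ γ : ℝ) • ψ x - (‖y‖ ^ γ : ℝ) • ψ y‖ ^ 2 /
        (2 * ‖x‖ ^ γ * ‖x - y‖ ^ ((n : ℝ) + a) * ‖y‖ ^ γ) = (‖x‖ ^ b + ‖y‖ ^ b) *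
      ‖(‖x‖ ^ γ : ℝ) • ψ x - (‖y‖ ^ γ : ℝ) • ψ y‖ ^ 2 / (2 * ‖x‖ ^ γ * ‖y‖ ^ γ) /
        ‖x - y‖ ^ ((n : ℝ) + a) := fun x y => by
    rw [div_div]
    ring_nf
  simp only [hperm]
  rw [← hn2, ← Measure.volume_eq_prod]
  refine mul_left_cancel₀ hΓ.ne' ?_
  rw [mul_left_comm, hv, mul_add, ← mul_assoc, hγ, alphaConst_mul_rieszFactor ha]
  ring
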